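/- Let Ω ⊂ ℝ^d be a bounded open set, s ∈ (0,1), and c ∈ (0,1). There exists a constant C > 0, depending only on Ω, s and c, such that: for every R > 0 with B_R ⊂ Ω (B_R a ball of radius R), every η ∈ C_0^∞(B_{cR}) (where B_{cR} is the concentric ball of radius cR), and every f ∈ L²(B_R) with |f|_{H^{1−s}(B_R)} < ∞, one has ‖ηf‖_{H^{1−s}(Ω)} ≤ C [ ( R^s ‖∇η‖_{L^∞(B_{cR})} + (R^{s−1}+1) ‖η‖_{L^∞(B_{cR})} ) ‖f‖_{L²(B_R)} + ‖η‖_{L^∞(B_{cR})} |f|_{H^{1−s}(B_R)} ]. -/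

import Mathlib

noncomputable section
open MeasureTheory Metric Set
open scoped ENNReal NNReal

section Kernels

variable {d : ℕ}

local notation "𝔼" => EuclideanSpace ℝ (Fin d)

lemma integrable_indicator_Iio_norm_rpow {p b : ℝ} (hp : -(d : ℝ) < p) (hb : 0 < b) :
    Integrable (fun y : 𝔼 => (Iio b).indicator (fun t : ℝ => t ^ p) ‖y‖) := by
  rcases Nat.eq_zero_or_pos d with rfl | hd
  · exact Integrable.of_finite
  have : Nontrivial 𝔼 := by
    have : Nonempty (Fin d) := ⟨⟨0, hd⟩⟩
    infer_instance
  rw [integrable_fun_norm_addHaar volume (f := (Iio b).indicator fun t : ℝ => t ^ p)]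
  simp only [finrank_euclideanSpace, Fintype.card_fin, smul_eq_mul]
  have key : IntegrableOn (fun t : ℝ => t ^ (p + d - 1)) (Ioo 0 b) :=
    (intervalIntegral.integrableOn_Ioo_rpow_iff hb).2 (by linarith)
  rw [← integrable_indicator_iff measurableSet_Ioo] at key
  refine key.integrableOn.congr_fun (fun t ht => ?_) measurableSet_Ioi
  have ht : 0 < t := ht
  by_cases htb : t < b
  · simp only [indicator, mem_Ioo, mem_Iio, ht, htb, and_self, if_true]
    rw [← Real.rpow_natCast, ← Real.rpow_add ht, Nat.cast_sub hd]
    congr 1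
    push_cast
    ring
  · simp [indicator, htb]

lemma integrable_indicator_Ici_norm_rpow {p b : ℝ} (hp : p < -(d : ℝ)) (hb : 0 < b) :
    Integrable (fun y : 𝔼 => (Ici b).indicator (fun t : ℝ => t ^ p) ‖y‖) := by
  rcases Nat.eq_zero_or_pos d with rfl | hd
  · exact Integrable.of_finite
  have : Nontrivial 𝔼 := by
    have : Nonempty (Fin d) := ⟨⟨0, hd⟩⟩
    infer_instance
  rw [integrable_fun_norm_addHaar volume (f := (Ici b).indicator fun t : ℝ => t ^ p)]
  simp only [finrank_euclideanSpace, Fintype.card_fin, smul_eq_mul]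
  have key : IntegrableOn (fun t : ℝ => t ^ (p + d - 1)) (Ici b) :=
    (integrableOn_Ici_iff_integrableOn_Ioi (by simp)).2 (integrableOn_Ioi_rpow_of_lt (by linarith) hb)
  rw [← integrable_indicator_iff measurableSet_Ici] at key
  refine key.integrableOn.congr_fun (fun t ht => ?_) measurableSet_Ioi
  have ht : 0 < t := ht
  by_cases htb : b ≤ t
  · simp only [indicator, mem_Ici, htb, if_true]
    rw [← Real.rpow_natCast, ← Real.rpow_add ht, Nat.cast_sub hd]
    congr 1
    push_cast
    ring
  · simp [indicator, htb]

lemma integrable_mul_sub_and_integral {h k : 𝔼 → ℝ} (hh : Integrable h) (hk : Integrable k) :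
    Integrable (fun q : 𝔼 × 𝔼 => h q.2 * k (q.1 - q.2)) ∧
      ∫ q : 𝔼 × 𝔼, h q.2 * k (q.1 - q.2) = (∫ x, h x) * ∫ y, k y := by
  have mp := measurePreserving_sub_prod (volume : Measure 𝔼) (volume : Measure 𝔼)
  have hi := hk.mul_prod hh
  constructor
  · refine ((mp.integrable_comp hi.aestronglyMeasurable).2 hi).congr (.of_forall fun q => ?_)
    simp [mul_comm]
  · have h1 := integral_map mp.measurable.aemeasurable
      (by rw [mp.map_eq]; exact hi.aestronglyMeasurable)
    rw [mp.map_eq, integral_prod_mul] at h1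
    rw [mul_comm, h1]
    exact integral_congr_ae (.of_forall fun q => mul_comm _ _)

lemma integrable_mul_sub_and_integral_fst {h k : 𝔼 → ℝ} (hh : Integrable h) (hk : Integrable k)
    (hk_even : ∀ y, k (-y) = k y) :
    Integrable (fun q : 𝔼 × 𝔼 => h q.1 * k (q.1 - q.2)) ∧
      ∫ q : 𝔼 × 𝔼, h q.1 * k (q.1 - q.2) = (∫ x, h x) * ∫ y, k y := by
  obtain ⟨h1, h2⟩ := integrable_mul_sub_and_integral hh hk
  have e : ∀ q : 𝔼 × 𝔼, h q.1 * k (q.1 - q.2) = h q.swap.2 * k (q.swap.1 - q.swap.2) := by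
    intro q
    simp [← hk_even (q.1 - q.2)]
  simp only [e]
  refine ⟨h1.swap, ?_⟩
  rw [← h2]
  exact integral_prod_swap (fun q : 𝔼 × 𝔼 => h q.2 * k (q.1 - q.2))

end Kernels

section Cutoff

lemma abs_le_sSup_image_of_tsupport_subset {E : Type*} [TopologicalSpace E] {η : E → ℝ}
    {U : Set E} (hη : Continuous η) (hc : HasCompactSupport η)
    (hU : tsupport η ⊆ U) (x : E) : |η x| ≤ sSup ((fun x => |η x|) '' U) := by
  by_cases hx : x ∈ U
  · refine le_csSup ?_ (mem_image_of_mem _ hx)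
    obtain ⟨M, hM⟩ := hη.bounded_above_of_compact_support hc
    exact ⟨M, by rintro _ ⟨y, -, rfl⟩; exact hM y⟩
  · rw [image_eq_zero_of_notMem_tsupport fun h => hx (hU h), abs_zero]
    exact Real.sSup_nonneg (by rintro _ ⟨y, -, rfl⟩; exact abs_nonneg _)

variable {E : Type*} [NormedAddCommGroup E] [NormedSpace ℝ E] {η : E → ℝ} {U : Set E}

lemma norm_fderiv_le_sSup_image_of_tsupport_subset (hη : ContDiff ℝ (⊤ : ℕ∞) η)
    (hc : HasCompactSupport η) (hU : tsupport η ⊆ U) (x : E) :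
    ‖fderiv ℝ η x‖ ≤ sSup ((fun x => ‖fderiv ℝ η x‖) '' U) := by
  by_cases hx : x ∈ U
  · refine le_csSup ?_ (mem_image_of_mem _ hx)
    obtain ⟨M, hM⟩ :=
      (hη.continuous_fderiv (by simp)).bounded_above_of_compact_support (hc.fderiv (𝕜 := ℝ))
    exact ⟨M, by rintro _ ⟨y, -, rfl⟩; exact hM y⟩
  · rw [fderiv_of_notMem_tsupport ℝ fun h => hx (hU h), norm_zero]
    exact Real.sSup_nonneg (by rintro _ ⟨y, -, rfl⟩; exact norm_nonneg _)

lemma abs_sub_le_of_tsupport_subset (hη : ContDiff ℝ (⊤ : ℕ∞) η) (hc : HasCompactSupport η)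
    (hU : tsupport η ⊆ U) (x z : E) :
    |η x - η z| ≤ sSup ((fun x => ‖fderiv ℝ η x‖) '' U) * dist x z := by
  rw [dist_eq_norm]
  exact convex_univ.norm_image_sub_le_of_norm_fderiv_le
    (fun y _ => (hη.differentiable (by simp)) y)
    (fun y _ => norm_fderiv_le_sSup_image_of_tsupport_subset hη hc hU y) (mem_univ z) (mem_univ x)

end Cutoff

section Domination

variable {d : ℕ}

local notation "𝔼" => EuclideanSpace ℝ (Fin d)

/-- Radial kernel dominating both the Lipschitz part (near the diagonal) and the interaction with
the complement of the ball (away from the diagonal) of the seminorm of a localized function. -/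
def localizationKernel (d : ℕ) (s c L N R : ℝ) (y : EuclideanSpace ℝ (Fin d)) : ℝ :=
  2 * L ^ 2 * R ^ (2 * s - d) *
      (Iio 2).indicator (fun t : ℝ => t ^ (2 * s - (d : ℝ))) ‖R⁻¹ • y‖ +
    N ^ 2 * R ^ (-((d : ℝ) + 2 * (1 - s))) *
      (Ici (1 - c)).indicator (fun t : ℝ => t ^ (-((d : ℝ) + 2 * (1 - s)))) ‖R⁻¹ • y‖

variable {s c L N R : ℝ}

lemma localizationKernel_neg (y : 𝔼) :
    localizationKernel d s c L N R (-y) = localizationKernel d s c L N R y := by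
  simp [localizationKernel]

lemma localizationKernel_near_nonneg (hR : 0 < R) (y : 𝔼) :
    0 ≤ 2 * L ^ 2 * R ^ (2 * s - d) *
      (Iio 2).indicator (fun t : ℝ => t ^ (2 * s - (d : ℝ))) ‖R⁻¹ • y‖ :=
  mul_nonneg (by positivity)
    (indicator_apply_nonneg fun _ => Real.rpow_nonneg (norm_nonneg _) _)

lemma localizationKernel_far_nonneg (hR : 0 < R) (y : 𝔼) :
    0 ≤ N ^ 2 * R ^ (-((d : ℝ) + 2 * (1 - s))) *
      (Ici (1 - c)).indicator (fun t : ℝ => t ^ (-((d : ℝ) + 2 * (1 - s)))) ‖R⁻¹ • y‖ :=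
  mul_nonneg (by positivity)
    (indicator_apply_nonneg fun _ => Real.rpow_nonneg (norm_nonneg _) _)

lemma localizationKernel_nonneg (hR : 0 < R) (y : 𝔼) :
    0 ≤ localizationKernel d s c L N R y :=
  add_nonneg (localizationKernel_near_nonneg hR y) (localizationKernel_far_nonneg hR y)

lemma norm_inv_smul_of_pos (hR : 0 < R) (y : 𝔼) : ‖R⁻¹ • y‖ = ‖y‖ / R := by
  rw [norm_smul, Real.norm_of_nonneg (inv_nonneg.2 hR.le), div_eq_inv_mul]

lemma mul_sq_div_rpow_le_localizationKernel (hR : 0 < R) {y : 𝔼} (hy : 0 < ‖y‖)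
    (h : ‖y‖ < 2 * R) :
    2 * L ^ 2 * (‖y‖ ^ 2 / ‖y‖ ^ ((d : ℝ) + 2 * (1 - s))) ≤ localizationKernel d s c L N R y := by
  refine le_trans (le_of_eq ?_) (le_add_of_nonneg_right (localizationKernel_far_nonneg hR y))
  rw [norm_inv_smul_of_pos hR, indicator_of_mem (by rwa [mem_Iio, div_lt_iff₀ hR]),
    Real.div_rpow hy.le hR.le, ← Real.rpow_natCast ‖y‖ 2, ← Real.rpow_sub hy,
    show ((2 : ℕ) : ℝ) - ((d : ℝ) + 2 * (1 - s)) = 2 * s - d by push_cast; ring]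
  have : R ^ (2 * s - (d : ℝ)) ≠ 0 := (Real.rpow_pos_of_pos hR _).ne'
  field_simp

lemma sq_div_rpow_le_localizationKernel (hR : 0 < R) {y : 𝔼}
    (h : (1 - c) * R ≤ ‖y‖) :
    N ^ 2 / ‖y‖ ^ ((d : ℝ) + 2 * (1 - s)) ≤ localizationKernel d s c L N R y := by
  refine le_trans (le_of_eq ?_) (le_add_of_nonneg_left (localizationKernel_near_nonneg hR y))
  rw [norm_inv_smul_of_pos hR, indicator_of_mem (by rwa [mem_Ici, le_div_iff₀ hR]),
    Real.div_rpow (norm_nonneg y) hR.le, Real.rpow_neg (norm_nonneg y)]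
  have : R ^ (-((d : ℝ) + 2 * (1 - s))) ≠ 0 := (Real.rpow_pos_of_pos hR _).ne'
  field_simp

lemma integrable_localizationKernel_and_integral (hs : s ∈ Ioo (0 : ℝ) 1) (hc : c < 1)
    (hR : 0 < R) :
    Integrable (localizationKernel d s c L N R) ∧
      ∫ y, localizationKernel d s c L N R y =
        2 * L ^ 2 * (R ^ s) ^ 2 *
            (∫ y : 𝔼, (Iio 2).indicator (fun t : ℝ => t ^ (2 * s - (d : ℝ))) ‖y‖) +
          N ^ 2 * (R ^ (s - 1)) ^ 2 *
            ∫ y : 𝔼, (Ici (1 - c)).indicator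
              (fun t : ℝ => t ^ (-((d : ℝ) + 2 * (1 - s)))) ‖y‖ := by
  have h1 : Integrable fun y : 𝔼 =>
      (Iio 2).indicator (fun t : ℝ => t ^ (2 * s - (d : ℝ))) ‖y‖ :=
    integrable_indicator_Iio_norm_rpow (by linarith [hs.1]) two_pos
  have h2 : Integrable fun y : 𝔼 =>
      (Ici (1 - c)).indicator (fun t : ℝ => t ^ (-((d : ℝ) + 2 * (1 - s)))) ‖y‖ :=
    integrable_indicator_Ici_norm_rpow (by linarith [hs.2]) (by linarith)
  have h1' := (h1.comp_smul (inv_ne_zero hR.ne')).const_mul (2 * L ^ 2 * R ^ (2 * s - (d : ℝ)))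
  have h2' := (h2.comp_smul (inv_ne_zero hR.ne')).const_mul
    (N ^ 2 * R ^ (-((d : ℝ) + 2 * (1 - s))))
  refine ⟨h1'.add h2', ?_⟩
  simp only [localizationKernel]
  rw [integral_add h1' h2', integral_const_mul, integral_const_mul,
    Measure.integral_comp_inv_smul_of_nonneg volume (fun y : 𝔼 =>
      (Iio 2).indicator (fun t : ℝ => t ^ (2 * s - (d : ℝ))) ‖y‖) hR.le,
    Measure.integral_comp_inv_smul_of_nonneg volume (fun y : 𝔼 =>
      (Ici (1 - c)).indicator (fun t : ℝ => t ^ (-((d : ℝ) + 2 * (1 - s)))) ‖y‖) hR.le]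
  have e1 : R ^ (2 * s - (d : ℝ)) * R ^ d = (R ^ s) ^ 2 := by
    rw [← Real.rpow_natCast R d, ← Real.rpow_add hR, ← Real.rpow_mul_natCast hR.le]
    congr 1
    push_cast
    ring
  have e2 : R ^ (-((d : ℝ) + 2 * (1 - s))) * R ^ d = (R ^ (s - 1)) ^ 2 := by
    rw [← Real.rpow_natCast R d, ← Real.rpow_add hR, ← Real.rpow_mul_natCast hR.le]
    congr 1
    push_cast
    ring
  rw [← e1, ← e2]
  simp only [finrank_euclideanSpace, Fintype.card_fin, smul_eq_mul]
  ring

lemma localized_quotient_le (hc : c ∈ Ioo (0 : ℝ) 1) (hR : 0 < R) {x₀ : 𝔼} {η f : 𝔼 → ℝ}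
    (hη : ∀ x ∉ ball x₀ (c * R), η x = 0) (hN : ∀ x, |η x| ≤ N)
    (hL : ∀ x z, |η x - η z| ≤ L * dist x z) (q : 𝔼 × 𝔼) :
    (η q.1 * f q.1 - η q.2 * f q.2) ^ 2 / dist q.1 q.2 ^ ((d : ℝ) + 2 * (1 - s)) ≤
      (ball x₀ R ×ˢ ball x₀ R).indicator (fun q : 𝔼 × 𝔼 => 2 * N ^ 2 *
          ((f q.1 - f q.2) ^ 2 / dist q.1 q.2 ^ ((d : ℝ) + 2 * (1 - s)))) q +
        ((ball x₀ R).indicator (fun x => f x ^ 2) q.1 *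
            localizationKernel d s c L N R (q.1 - q.2) +
          (ball x₀ R).indicator (fun x => f x ^ 2) q.2 *
            localizationKernel d s c L N R (q.1 - q.2)) := by
  obtain ⟨x, z⟩ := q
  dsimp only
  set k := localizationKernel d s c L N R (x - z) with hk
  have hk0 : 0 ≤ k := localizationKernel_nonneg hR _
  have hh : ∀ x, 0 ≤ (ball x₀ R).indicator (fun x => f x ^ 2) x := fun x =>
    indicator_apply_nonneg fun _ => sq_nonneg _
  have hK : 0 ≤ (ball x₀ R ×ˢ ball x₀ R).indicator (fun q : 𝔼 × 𝔼 => 2 * N ^ 2 *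
      ((f q.1 - f q.2) ^ 2 / dist q.1 q.2 ^ ((d : ℝ) + 2 * (1 - s)))) (x, z) :=
    indicator_apply_nonneg fun _ => by positivity
  have hx0 := mul_nonneg (hh x) hk0
  have hz0 := mul_nonneg (hh z) hk0
  have hsub : ball x₀ (c * R) ⊆ ball x₀ R := ball_subset_ball (by nlinarith [hc.2])
  rcases eq_or_ne x z with rfl | hxz
  · simp only [sub_self, ne_eq, OfNat.ofNat_ne_zero, not_false_eq_true, zero_pow, zero_div]
    linarith
  have hr : 0 < ‖x - z‖ := norm_pos_iff.2 (sub_ne_zero.2 hxz)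
  have hη2 : ∀ x, (η x) ^ 2 ≤ N ^ 2 := fun x => sq_le_sq' (abs_le.1 (hN x)).1 (abs_le.1 (hN x)).2
  have far : ∀ u v, u ∈ ball x₀ (c * R) → v ∉ ball x₀ R → (1 - c) * R ≤ dist u v := by
    intro u v hu hv
    rw [mem_ball] at hu hv
    linarith [dist_triangle_left v x₀ u]
  have one_sided : ∀ u, (1 - c) * R ≤ ‖x - z‖ → u ∈ ball x₀ R →
      (η u * f u) ^ 2 / ‖x - z‖ ^ ((d : ℝ) + 2 * (1 - s)) ≤
        (ball x₀ R).indicator (fun x => f x ^ 2) u * k := by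
    intro u hfar hu
    rw [indicator_of_mem hu]
    calc (η u * f u) ^ 2 / ‖x - z‖ ^ ((d : ℝ) + 2 * (1 - s))
        ≤ (N ^ 2 * f u ^ 2) / ‖x - z‖ ^ ((d : ℝ) + 2 * (1 - s)) := by
          rw [mul_pow]
          have := hη2 u
          gcongr ?_ * _ / _
      _ = f u ^ 2 * (N ^ 2 / ‖x - z‖ ^ ((d : ℝ) + 2 * (1 - s))) := by ring
      _ ≤ _ := mul_le_mul_of_nonneg_left (sq_div_rpow_le_localizationKernel hR hfar)
          (sq_nonneg _)
  by_cases hx : x ∈ ball x₀ R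
  · by_cases hz : z ∈ ball x₀ R
    · have hnear : ‖x - z‖ < 2 * R := by
        rw [← dist_eq_norm]
        rw [mem_ball] at hx hz
        linarith [dist_triangle_right x z x₀]
      have hkn := mul_sq_div_rpow_le_localizationKernel (s := s) (c := c) (L := L) (N := N)
        hR hr hnear
      rw [indicator_of_mem (mk_mem_prod hx hz)]
      rw [indicator_of_mem hz] at hz0 ⊢
      have hstep : (η x * f x - η z * f z) ^ 2 / dist x z ^ ((d : ℝ) + 2 * (1 - s)) ≤
          2 * N ^ 2 * ((f x - f z) ^ 2 / dist x z ^ ((d : ℝ) + 2 * (1 - s))) + f z ^ 2 *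
            (2 * L ^ 2 * (‖x - z‖ ^ 2 / ‖x - z‖ ^ ((d : ℝ) + 2 * (1 - s)))) := by
        rw [← dist_eq_norm]
        have hD : 0 < dist x z ^ ((d : ℝ) + 2 * (1 - s)) :=
          Real.rpow_pos_of_pos (dist_pos.2 hxz) _
        rw [← mul_div_assoc, ← mul_div_assoc, ← mul_div_assoc, ← add_div]
        gcongr
        have hL2 : (η x - η z) ^ 2 ≤ (L * dist x z) ^ 2 :=
          sq_le_sq' (abs_le.1 (hL x z)).1 (abs_le.1 (hL x z)).2
        have a1 := mul_le_mul_of_nonneg_left (hη2 x) (sq_nonneg (f x - f z))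
        have a2 := mul_le_mul_of_nonneg_left hL2 (sq_nonneg (f z))
        nlinarith [sq_nonneg (η x * (f x - f z) - f z * (η x - η z))]
      have := mul_le_mul_of_nonneg_left hkn (sq_nonneg (f z))
      linarith
    · have hz' : η z = 0 := hη z fun h => hz (hsub h)
      by_cases hxc : x ∈ ball x₀ (c * R)
      · have := one_sided x (by rw [← dist_eq_norm]; exact far x z hxc hz) hx
        rw [hz', zero_mul, sub_zero, dist_eq_norm]
        linarith
      · rw [hη x hxc, hz']
        simp only [zero_mul, sub_zero, ne_eq, OfNat.ofNat_ne_zero, not_false_eq_true, zero_pow,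
          zero_div]
        linarith
  · have hx' : η x = 0 := hη x fun h => hx (hsub h)
    by_cases hzc : z ∈ ball x₀ (c * R)
    · have := one_sided z (by rw [← dist_eq_norm, dist_comm]; exact far z x hzc hx) (hsub hzc)
      rw [hx', zero_mul, zero_sub, neg_sq, dist_eq_norm]
      linarith
    · rw [hη z hzc, hx']
      simp only [zero_mul, sub_zero, ne_eq, OfNat.ofNat_ne_zero, not_false_eq_true, zero_pow,
        zero_div]
      linarith

end Domination

lemma sqrt_le_mul_add_of_le {A₁ A₂ ρ σ L N F G S : ℝ} (hA₁ : 0 ≤ A₁) (hA₂ : 0 ≤ A₂) (hρ : 0 ≤ ρ)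
    (hσ : 0 ≤ σ) (hL : 0 ≤ L) (hN : 0 ≤ N) (hF : 0 ≤ F) (hG : 0 ≤ G)
    (hS : S ≤ N ^ 2 * F +
      (2 * N ^ 2 * G + 2 * (F * (2 * L ^ 2 * ρ ^ 2 * A₁ + N ^ 2 * σ ^ 2 * A₂)))) :
    √S ≤ (2 + 4 * A₁ + 4 * A₂) * ((ρ * L + (σ + 1) * N) * √F + N * √G) := by
  rw [Real.sqrt_le_left (by positivity)]
  obtain ⟨C, hC⟩ : ∃ C, C = 2 + 4 * A₁ + 4 * A₂ := ⟨_, rfl⟩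
  have hCC : C ≤ C ^ 2 := by nlinarith
  have h1 : N ^ 2 * F ≤ C ^ 2 * (N ^ 2 * F) :=
    le_mul_of_one_le_left (by positivity) (by linarith)
  have h2 : 2 * (N ^ 2 * G) ≤ C ^ 2 * (N ^ 2 * G) :=
    mul_le_mul_of_nonneg_right (by linarith) (by positivity)
  have h3 : (4 * A₁) * (F * L ^ 2 * ρ ^ 2) ≤ C ^ 2 * (F * L ^ 2 * ρ ^ 2) :=
    mul_le_mul_of_nonneg_right (by linarith) (by positivity)
  have h4 : (2 * A₂) * (F * N ^ 2 * σ ^ 2) ≤ C ^ 2 * (F * N ^ 2 * σ ^ 2) :=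
    mul_le_mul_of_nonneg_right (by linarith) (by positivity)
  have h5 : N ^ 2 * F + N ^ 2 * G + F * L ^ 2 * ρ ^ 2 + F * N ^ 2 * σ ^ 2 ≤
      ((ρ * L + (σ + 1) * N) * √F + N * √G) ^ 2 := by
    obtain ⟨a, ha⟩ : ∃ a, a = √F := ⟨_, rfl⟩
    obtain ⟨b, hb⟩ : ∃ b, b = √G := ⟨_, rfl⟩
    have ha0 : 0 ≤ a := ha ▸ Real.sqrt_nonneg F
    have hb0 : 0 ≤ b := hb ▸ Real.sqrt_nonneg G
    rw [← ha, ← hb, ← Real.sq_sqrt hF, ← Real.sq_sqrt hG, ← ha, ← hb, ← sub_nonneg]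
    ring_nf
    positivity
  rw [← hC, mul_pow]
  have h6 := mul_le_mul_of_nonneg_left h5 (sq_nonneg C)
  linarith

/-- localization of fractional norms, Lemma A.1. -/
theorem statement7 (d : ℕ) (Ω : Set (EuclideanSpace ℝ (Fin d))) (hΩo : IsOpen Ω)
    (hΩb : Bornology.IsBounded Ω) (s : ℝ) (hs : s ∈ Set.Ioo (0 : ℝ) 1)
    (c : ℝ) (hc : c ∈ Set.Ioo (0 : ℝ) 1) :
    ∃ C : ℝ, 0 < C ∧
      ∀ (x₀ : EuclideanSpace ℝ (Fin d)) (R : ℝ), 0 < R → Metric.ball x₀ R ⊆ Ω →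
      ∀ η : EuclideanSpace ℝ (Fin d) → ℝ, ContDiff ℝ (⊤ : ℕ∞) η → HasCompactSupport η →
        tsupport η ⊆ Metric.ball x₀ (c * R) →
      ∀ f : EuclideanSpace ℝ (Fin d) → ℝ,
        MeasureTheory.IntegrableOn (fun x => (f x) ^ 2) (Metric.ball x₀ R) →
        MeasureTheory.IntegrableOn
          (fun q : EuclideanSpace ℝ (Fin d) × EuclideanSpace ℝ (Fin d) =>
            (f q.1 - f q.2) ^ 2 / dist q.1 q.2 ^ ((d : ℝ) + 2 * (1 - s)))
          (Metric.ball x₀ R ×ˢ Metric.ball x₀ R) →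
        Real.sqrt ((∫ x in Ω, (η x * f x) ^ 2) +
            ∫ q in Ω ×ˢ Ω,
              (η q.1 * f q.1 - η q.2 * f q.2) ^ 2 / dist q.1 q.2 ^ ((d : ℝ) + 2 * (1 - s)))
          ≤ C * ((R ^ s * sSup ((fun x => ‖fderiv ℝ η x‖) '' Metric.ball x₀ (c * R))
                + (R ^ (s - 1) + 1) * sSup ((fun x => |η x|) '' Metric.ball x₀ (c * R))) *
                  Real.sqrt (∫ x in Metric.ball x₀ R, (f x) ^ 2)
              + sSup ((fun x => |η x|) '' Metric.ball x₀ (c * R)) *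
                  Real.sqrt (∫ q in Metric.ball x₀ R ×ˢ Metric.ball x₀ R,
                    (f q.1 - f q.2) ^ 2 / dist q.1 q.2 ^ ((d : ℝ) + 2 * (1 - s)))) := by
  have hA₁ : 0 ≤ ∫ y : EuclideanSpace ℝ (Fin d),
      (Iio 2).indicator (fun t : ℝ => t ^ (2 * s - (d : ℝ))) ‖y‖ :=
    integral_nonneg fun y => indicator_apply_nonneg fun _ => Real.rpow_nonneg (norm_nonneg _) _
  have hA₂ : 0 ≤ ∫ y : EuclideanSpace ℝ (Fin d),
      (Ici (1 - c)).indicator (fun t : ℝ => t ^ (-((d : ℝ) + 2 * (1 - s)))) ‖y‖ :=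
    integral_nonneg fun y => indicator_apply_nonneg fun _ => Real.rpow_nonneg (norm_nonneg _) _
  refine ⟨_, by positivity, fun x₀ R hR _ η hη hηc hηs f hf hK =>
    sqrt_le_mul_add_of_le hA₁ hA₂ (Real.rpow_nonneg hR.le s) (Real.rpow_nonneg hR.le (s - 1))
      (Real.sSup_nonneg (by rintro _ ⟨y, -, rfl⟩; exact norm_nonneg _))
      (Real.sSup_nonneg (by rintro _ ⟨y, -, rfl⟩; exact abs_nonneg _))
      (integral_nonneg fun _ => sq_nonneg _) (integral_nonneg fun _ => by positivity) ?_⟩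
  have hL := abs_sub_le_of_tsupport_subset hη hηc hηs
  have hN := abs_le_sSup_image_of_tsupport_subset hη.continuous hηc hηs
  set L := sSup ((fun x => ‖fderiv ℝ η x‖) '' ball x₀ (c * R))
  set N := sSup ((fun x => |η x|) '' ball x₀ (c * R))
  have hη0 : ∀ x ∉ ball x₀ (c * R), η x = 0 := fun x hx =>
    image_eq_zero_of_notMem_tsupport fun h => hx (hηs h)
  have hsub : ball x₀ (c * R) ⊆ ball x₀ R := ball_subset_ball (by nlinarith [hc.2])
  have hh : Integrable ((ball x₀ R).indicator fun x => f x ^ 2) :=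
    (integrable_indicator_iff measurableSet_ball).2 hf
  refine add_le_add ?_ ?_
  · rw [← integral_indicator measurableSet_ball, ← integral_const_mul]
    have hi := hh.const_mul (N ^ 2)
    have hnn : ∀ x, 0 ≤ N ^ 2 * (ball x₀ R).indicator (fun x => f x ^ 2) x := fun x =>
      mul_nonneg (sq_nonneg _) (indicator_apply_nonneg fun _ => sq_nonneg _)
    refine (integral_mono_of_nonneg (.of_forall fun _ => sq_nonneg _) hi.restrict
      (.of_forall fun x => ?_)).trans (setIntegral_le_integral hi (.of_forall hnn))
    by_cases hx : x ∈ ball x₀ R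
    · simp only [indicator_of_mem hx, mul_pow]
      have := sq_le_sq' (abs_le.1 (hN x)).1 (abs_le.1 (hN x)).2
      gcongr ?_ * _
    · have h0 := hη0 x fun h => hx (hsub h)
      simp [h0, indicator_of_notMem hx]
  · obtain ⟨hk, hk_int⟩ := integrable_localizationKernel_and_integral (d := d) (L := L) (N := N)
      hs hc.2 hR
    obtain ⟨i₁, e₁⟩ := integrable_mul_sub_and_integral_fst hh hk localizationKernel_neg
    obtain ⟨i₂, e₂⟩ := integrable_mul_sub_and_integral hh hk
    have i₃ := (integrable_indicator_iff (measurableSet_ball.prod measurableSet_ball)).2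
      (hK.const_mul (2 * N ^ 2))
    have e₃ := integral_indicator (μ := volume)
      (f := fun q : EuclideanSpace ℝ (Fin d) × EuclideanSpace ℝ (Fin d) =>
        2 * N ^ 2 * ((f q.1 - f q.2) ^ 2 / dist q.1 q.2 ^ ((d : ℝ) + 2 * (1 - s))))
      ((measurableSet_ball (x := x₀) (ε := R)).prod (measurableSet_ball (x := x₀) (ε := R)))
    rw [integral_const_mul] at e₃
    have hi := i₃.add (i₁.add i₂)
    have hle := localized_quotient_le (s := s) (f := f) hc hR hη0 hN hL
    have hq : ∀ q : EuclideanSpace ℝ (Fin d) × EuclideanSpace ℝ (Fin d), 0 ≤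
        (η q.1 * f q.1 - η q.2 * f q.2) ^ 2 / dist q.1 q.2 ^ ((d : ℝ) + 2 * (1 - s)) :=
      fun q => by positivity
    refine ((integral_mono_of_nonneg (.of_forall hq) hi.restrict (.of_forall hle)).trans
      (setIntegral_le_integral hi (.of_forall fun q => (hq q).trans (hle q)))).trans_eq ?_
    rw [integral_add' i₃ (i₁.add i₂), integral_add' i₁ i₂, e₁, e₂, e₃, hk_int,
      integral_indicator measurableSet_ball]
    ring
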